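/- Define T₀(5) = −0.1382, T₀(6) = −0.0711, T₀(7) = −0.01362, ρ₂(5) = 0.913, ρ₂(6) = 0.952, ρ₂(7) = 0.99, and set R(5) = 0.9957, R(6) = R(7) = 1. For each n ∈ {5, 6, 7}, each t with T₀(n) ≤ t ≤ 0, and each ρ with ρ₂(n) ≤ ρ ≤ R(n), one has I(regPerim(ρπ/3 − t, n), n, t, ρ) > 0, i.e., regPerim(ρπ/3 − t, n) − t·B' + (5 − n)·p₅' − ρ·p₅ > 0. -/

import Mathlib

open Real

/-- Perimeter of a regular spherical `n`-gon of area `x` on the unit sphere. -/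
noncomputable def regPerim (x n : ℝ) : ℝ :=
  n * Real.arccos ((Real.cos (2 * π / n) +
      (Real.cos ((π - (2 * π - x) / n) / 2)) ^ 2) /
      (Real.sin ((π - (2 * π - x) / n) / 2)) ^ 2)

/-- Circumference of a circle on the unit sphere enclosing area `a`. -/
noncomputable def circPerim0 (a : ℝ) : ℝ := Real.sqrt (4 * π * a - a ^ 2)

/-- Perimeter of the regular spherical pentagon of area `π/3`. -/
noncomputable def p5 : ℝ := 5 * Real.arccos ((4 * Real.cos (2 * π / 5) + 1) / 3)

/-- Derivative at `n = 5` of `n ↦ regPerim (π/3) n`. -/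
noncomputable def p5' : ℝ := deriv (fun n : ℝ => regPerim (π / 3) n) 5

/-- `B' = -∂₁ regPerim (π/3, 5)`. -/
noncomputable def B' : ℝ := - deriv (fun x : ℝ => regPerim x 5) (π / 3)

/-- The isoperimetric functional `I(ℓ, n, t, ρ)`. -/
noncomputable def Ifun (ℓ n t ρ : ℝ) : ℝ := ℓ - t * B' + (5 - n) * p5' - ρ * p5

/-- The constant `ρ₁` of the proof (values specified only for `n = 5, 6, 7`). -/
noncomputable def rho1 : ℕ → ℝ
  | 5 => 0.913
  | 6 => 0.952
  | 7 => 0.99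
  | _ => 1

/-- The constant `T₁` of the proof (values specified only for `n = 5, 6, 7`). -/
noncomputable def T1 : ℕ → ℝ
  | 5 => 0.117
  | 6 => 0.065
  | 7 => 0.0134
  | _ => 0

/-- The constant `T₀` of the proof (values specified only for `n = 5, 6, 7`). -/
noncomputable def T0 : ℕ → ℝ
  | 5 => -0.1382
  | 6 => -0.0711
  | 7 => -0.01362
  | _ => 0

/-- The constant `ρ₂` of the proof (values specified only for `n = 5, 6, 7`). -/
noncomputable def rho2 : ℕ → ℝ
  | 5 => 0.913
  | 6 => 0.952
  | 7 => 0.99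
  | _ => 1

/-- The upper bound `R(n)`: `0.9957` for `n = 5` and `1` otherwise. -/
noncomputable def Rbd : ℕ → ℝ
  | 5 => 0.9957
  | _ => 1

/-- The area lower bound `a(n) = min (3.75 / n², 0.1)`. -/
noncomputable def aFn (n : ℕ) : ℝ := min (3.75 / (n : ℝ) ^ 2) 0.1

/-- A function vanishing at `0` with nonnegative derivative is nonnegative on `[0, ∞)`. -/
theorem nonneg_of_hasDerivAt_nonneg {f f' : ℝ → ℝ} (hf : ∀ x, HasDerivAt f (f' x) x)
    (h0 : f 0 = 0) (hf' : ∀ x, 0 ≤ x → 0 ≤ f' x) {x : ℝ} (hx : 0 ≤ x) : 0 ≤ f x := by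
  have hmono : MonotoneOn f (Set.Ici 0) := by
    refine monotoneOn_of_hasDerivWithinAt_nonneg (convex_Ici 0)
      (fun y _ => (hf y).continuousAt.continuousWithinAt)
      (fun y _ => (hf y).hasDerivWithinAt) ?_
    intro y hy
    rw [interior_Ici] at hy
    exact hf' y (le_of_lt hy)
  simpa [h0] using hmono Set.self_mem_Ici hx hx

theorem sin_le_taylor_five {x : ℝ} (hx : 0 ≤ x) : sin x ≤ x - x ^ 3 / 6 + x ^ 5 / 120 := by
  have h3 {x : ℝ} (hx : 0 ≤ x) : x - x ^ 3 / 6 ≤ sin x := by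
    rcases hx.eq_or_lt with rfl | h
    · simp
    · exact (sin_gt_sub_cube h).le
  have h4 {x : ℝ} (hx : 0 ≤ x) : cos x ≤ 1 - x ^ 2 / 2 + x ^ 4 / 24 := by
    have := nonneg_of_hasDerivAt_nonneg (f := fun x => (1 - x ^ 2 / 2 + x ^ 4 / 24) - cos x)
      (f' := fun x => sin x - (x - x ^ 3 / 6))
      (fun x => by
        refine ((((((hasDerivAt_id x).pow 2).div_const 2).const_sub 1).add
          (((hasDerivAt_id x).pow 4).div_const 24)).sub (hasDerivAt_cos x)).congr_deriv ?_
        simp; ring)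
      (by simp) (fun x hx => sub_nonneg.2 (h3 hx)) hx
    linarith
  have := nonneg_of_hasDerivAt_nonneg (f := fun x => (x - x ^ 3 / 6 + x ^ 5 / 120) - sin x)
    (f' := fun x => (1 - x ^ 2 / 2 + x ^ 4 / 24) - cos x)
    (fun x => by
      refine ((((hasDerivAt_id x).sub (((hasDerivAt_id x).pow 3).div_const 6)).add
        (((hasDerivAt_id x).pow 5).div_const 120)).sub (hasDerivAt_sin x)).congr_deriv ?_
      simp; ring)
    (by simp) (fun x hx => sub_nonneg.2 (h4 hx)) hx
  linarith

theorem taylor_six_le_cos {x : ℝ} (hx : 0 ≤ x) :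
    1 - x ^ 2 / 2 + x ^ 4 / 24 - x ^ 6 / 720 ≤ cos x := by
  have := nonneg_of_hasDerivAt_nonneg
    (f := fun x => cos x - (1 - x ^ 2 / 2 + x ^ 4 / 24 - x ^ 6 / 720))
    (f' := fun x => (x - x ^ 3 / 6 + x ^ 5 / 120) - sin x)
    (fun x => by
      refine ((hasDerivAt_cos x).sub ((((((hasDerivAt_id x).pow 2).div_const 2).const_sub 1).add
        (((hasDerivAt_id x).pow 4).div_const 24)).sub
          (((hasDerivAt_id x).pow 6).div_const 720))).congr_deriv ?_
      simp; ring)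
    (by simp) (fun x hx => sub_nonneg.2 (sin_le_taylor_five hx)) hx
  linarith

theorem cos_le_taylor_eight {x : ℝ} (hx : 0 ≤ x) :
    cos x ≤ 1 - x ^ 2 / 2 + x ^ 4 / 24 - x ^ 6 / 720 + x ^ 8 / 40320 := by
  have h7 {x : ℝ} (hx : 0 ≤ x) : x - x ^ 3 / 6 + x ^ 5 / 120 - x ^ 7 / 5040 ≤ sin x := by
    have := nonneg_of_hasDerivAt_nonneg
      (f := fun x => sin x - (x - x ^ 3 / 6 + x ^ 5 / 120 - x ^ 7 / 5040))
      (f' := fun x => cos x - (1 - x ^ 2 / 2 + x ^ 4 / 24 - x ^ 6 / 720))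
      (fun x => by
        refine ((hasDerivAt_sin x).sub ((((hasDerivAt_id x).sub
          (((hasDerivAt_id x).pow 3).div_const 6)).add
            (((hasDerivAt_id x).pow 5).div_const 120)).sub
              (((hasDerivAt_id x).pow 7).div_const 5040))).congr_deriv ?_
        simp; ring)
      (by simp) (fun x hx => sub_nonneg.2 (taylor_six_le_cos hx)) hx
    linarith
  have := nonneg_of_hasDerivAt_nonneg
    (f := fun x => (1 - x ^ 2 / 2 + x ^ 4 / 24 - x ^ 6 / 720 + x ^ 8 / 40320) - cos x)
    (f' := fun x => sin x - (x - x ^ 3 / 6 + x ^ 5 / 120 - x ^ 7 / 5040))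
    (fun x => by
      refine ((((((((hasDerivAt_id x).pow 2).div_const 2).const_sub 1).add
        (((hasDerivAt_id x).pow 4).div_const 24)).sub
          (((hasDerivAt_id x).pow 6).div_const 720)).add
            (((hasDerivAt_id x).pow 8).div_const 40320)).sub (hasDerivAt_cos x)).congr_deriv ?_
      simp; ring)
    (by simp) (fun x hx => sub_nonneg.2 (h7 hx)) hx
  linarith

/-- A lower bound for the product of two cosines is inherited by segments. -/
theorem le_cos_mul_cos_of_segment {A₀ A₁ Y₀ Y₁ c s : ℝ}
    (h₀ : c ≤ cos A₀ * cos Y₀) (h₁ : c ≤ cos A₁ * cos Y₁)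
    (hA₀ : 0 ≤ A₀) (hA₁ : 0 ≤ A₁) (hY₀ : 0 ≤ Y₀) (hY₁ : 0 ≤ Y₁)
    (hAY₀ : A₀ + Y₀ ≤ π / 2) (hAY₁ : A₁ + Y₁ ≤ π / 2) (hs₀ : 0 ≤ s) (hs₁ : s ≤ 1) :
    c ≤ cos ((1 - s) * A₀ + s * A₁) * cos ((1 - s) * Y₀ + s * Y₁) := by
  have prod_eq (a y : ℝ) : cos a * cos y = (cos (a + y) + cos (a - y)) / 2 := by
    rw [cos_add, cos_sub]; ring
  have hconc := strictConcaveOn_cos_Icc.concaveOn.2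
  have hadd := @hconc (A₀ + Y₀) ⟨by linarith, by linarith⟩ (A₁ + Y₁) ⟨by linarith, by linarith⟩
    (1 - s) s (by linarith) hs₀ (by ring)
  have hsub := @hconc (A₀ - Y₀) ⟨by linarith, by linarith⟩ (A₁ - Y₁) ⟨by linarith, by linarith⟩
    (1 - s) s (by linarith) hs₀ (by ring)
  simp only [smul_eq_mul] at hadd hsub
  rw [prod_eq] at h₀ h₁ ⊢
  rw [show (1 - s) * A₀ + s * A₁ + ((1 - s) * Y₀ + s * Y₁)
      = (1 - s) * (A₀ + Y₀) + s * (A₁ + Y₁) by ring,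
    show (1 - s) * A₀ + s * A₁ - ((1 - s) * Y₀ + s * Y₁)
      = (1 - s) * (A₀ - Y₀) + s * (A₁ - Y₁) by ring]
  nlinarith [mul_le_mul_of_nonneg_left h₀ (sub_nonneg.2 hs₁), mul_le_mul_of_nonneg_left h₁ hs₀]

/-- The half side `A` of the regular `n`-gon satisfies `cos A * cos Y = cos (π / n)`, where `Y` is
the complement of half its interior angle; smaller `A` bound the perimeter from below. -/
theorem le_regPerim {x n A : ℝ} (hn : 2 < n) (hA₀ : 0 ≤ A) (hA₁ : A ≤ π / 2)
    (hx₀ : 0 ≤ x) (hx : x ≤ 2 * π) (h : cos (π / n) ≤ cos A * cos ((2 * π - x) / (2 * n))) :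
    2 * n * A ≤ regPerim x n := by
  set y := (2 * π - x) / (2 * n) with hy
  have hn₀ : 0 < n := by linarith
  have hc : 0 ≤ cos (π / n) := by
    apply cos_nonneg_of_neg_pi_div_two_le_of_le
    · linarith [pi_pos, div_nonneg pi_pos.le hn₀.le]
    · exact div_le_div_of_nonneg_left pi_pos.le two_pos hn.le
  have hy₀ : 0 ≤ y := div_nonneg (by linarith) (by linarith)
  have hy₁ : y < π / 2 := by
    rw [hy, div_lt_div_iff₀ (by linarith) two_pos]
    nlinarith [pi_pos]
  have hcy : 0 < cos y := cos_pos_of_mem_Ioo ⟨by linarith [pi_pos], hy₁⟩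
  have hα : (π - (2 * π - x) / n) / 2 = π / 2 - y := by rw [hy]; field_simp
  have h2 : cos (2 * π / n) = 2 * cos (π / n) ^ 2 - 1 := by
    rw [← cos_two_mul]; congr 1; ring
  unfold regPerim
  rw [hα, sin_pi_div_two_sub, cos_pi_div_two_sub, h2]
  have harc : 2 * A ≤ arccos ((2 * cos (π / n) ^ 2 - 1 + sin y ^ 2) / cos y ^ 2) := by
    rw [← arccos_cos (show 0 ≤ 2 * A by linarith) (show 2 * A ≤ π by linarith)]
    apply arccos_le_arccos
    rw [div_le_iff₀ (by positivity), cos_two_mul, sin_sq]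
    have := pow_le_pow_left₀ hc h 2
    nlinarith
  nlinarith

theorem cos_two_pi_div_five : cos (2 * π / 5) = (√5 - 1) / 4 := by
  rw [show 2 * π / 5 = 2 * (π / 5) by ring, cos_two_mul, cos_pi_div_five]
  nlinarith [sq_sqrt (show (0 : ℝ) ≤ 5 by norm_num)]

theorem arccos_sqrt_five_div_three_le : arccos (√5 / 3) ≤ 0.72973 := by
  have h5 : 2.2360679 ≤ √5 := le_sqrt_of_sq_le (by norm_num)
  rw [← arccos_cos (show (0 : ℝ) ≤ 0.72973 by norm_num) (by linarith [pi_gt_three])]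
  apply arccos_le_arccos
  have := cos_le_taylor_eight (show (0 : ℝ) ≤ 0.72973 by norm_num)
  norm_num at this ⊢
  linarith

theorem p5_le : p5 ≤ 3.64865 := by
  have h := arccos_sqrt_five_div_three_le
  have : p5 = 5 * arccos (√5 / 3) := by
    rw [p5, cos_two_pi_div_five]; ring_nf
  rw [this]
  linarith

/-- The cosine of the side of the regular pentagon of area `π / 3`. -/
theorem cos_side_eq :
    (cos (2 * π / 5) + cos (π / 3) ^ 2) / sin (π / 3) ^ 2 = √5 / 3 := by
  rw [cos_two_pi_div_five, cos_pi_div_three, sin_pi_div_three]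
  simp only [div_pow, sq_sqrt (show (0 : ℝ) ≤ 3 by norm_num)]
  ring

/-- Chain rule for the side of a regular polygon, at the regular pentagon of area `π / 3`, whose
interior angle is `2π / 3`. -/
theorem hasDerivAt_arccos_cos_side {f g : ℝ → ℝ} {f' g' a : ℝ} (hf : HasDerivAt f f' a)
    (hg : HasDerivAt g g' a) (hfa : f a = 2 * π / 5) (hga : g a = π / 3) :
    HasDerivAt (fun z => arccos ((cos (f z) + cos (g z) ^ 2) / sin (g z) ^ 2))
      (2 * sin (2 * π / 5) * f' + √3 * (1 + √5 / 3) * g') a := by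
  have h3 : √3 * √3 = 3 := mul_self_sqrt (by norm_num)
  have h5 : √5 * √5 = 5 := mul_self_sqrt (by norm_num)
  have hval : (cos (f a) + cos (g a) ^ 2) / sin (g a) ^ 2 = √5 / 3 := by
    rw [hfa, hga, cos_side_eq]
  have hs : sin (g a) ≠ 0 := by rw [hga, sin_pi_div_three]; positivity
  have hsqrt : √(1 - (√5 / 3) ^ 2) = 2 / 3 := by
    rw [show 1 - (√5 / 3) ^ 2 = (2 / 3) ^ 2 by nlinarith]
    exact sqrt_sq (by norm_num)
  have hlt : √5 < 3 := by nlinarith [sqrt_nonneg 5]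
  have harc := hasDerivAt_arccos (x := √5 / 3) (by linarith [sqrt_nonneg 5]) (by linarith)
  have hq := (hf.cos.add (hg.cos.pow 2)).div (hg.sin.pow 2) (pow_ne_zero 2 hs)
  rw [hsqrt, ← hval] at harc
  refine (harc.comp a hq).congr_deriv ?_
  simp only [Pi.add_apply, Pi.pow_apply, hfa, hga, cos_two_pi_div_five, cos_pi_div_three,
    sin_pi_div_three]
  norm_num
  rw [show (√3 / 2) ^ 2 = 3 / 4 by rw [div_pow, pow_two √3, h3]; norm_num]
  ring

theorem B'_ge : -1.51154 ≤ B' := by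
  have hg : HasDerivAt (fun x : ℝ => (π - (2 * π - x) / 5) / 2) (1 / 10) (π / 3) :=
    (((((hasDerivAt_id (π / 3)).const_sub (2 * π)).div_const 5).const_sub π).div_const
      2).congr_deriv (by norm_num)
  have hB := (hasDerivAt_arccos_cos_side (hasDerivAt_const (π / 3) (2 * π / 5)) hg rfl
    (by ring)).const_mul 5
  have h3 : √3 ≤ 1.73205081 := sqrt_le_iff.2 ⟨by norm_num, by norm_num⟩
  have h5 : √5 ≤ 2.236068 := sqrt_le_iff.2 ⟨by norm_num, by norm_num⟩
  have h35 : √3 * (1 + √5 / 3) ≤ 1.73205081 * (1 + 2.236068 / 3) := by gcongr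
  rw [B']
  unfold regPerim
  rw [hB.deriv]
  linarith

theorem p5'_le : p5' ≤ -0.069 := by
  have hf : HasDerivAt (fun n : ℝ => 2 * π / n) (-(2 * π / 25)) 5 :=
    ((hasDerivAt_const (5 : ℝ) (2 * π)).div (hasDerivAt_id 5) (by norm_num)).congr_deriv
      (by norm_num; ring)
  have hg : HasDerivAt (fun n : ℝ => (π - (2 * π - π / 3) / n) / 2) (π / 30) 5 :=
    ((((hasDerivAt_const (5 : ℝ) (2 * π - π / 3)).div (hasDerivAt_id 5)
      (by norm_num)).const_sub π).div_const 2).congr_deriv (by norm_num; ring)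
  have hga : (π - (2 * π - π / 3) / 5) / 2 = π / 3 := by ring
  have hp := (hasDerivAt_id (5 : ℝ)).mul (hasDerivAt_arccos_cos_side hf hg rfl hga)
  have h3 : √3 ≤ 1.7321 := sqrt_le_iff.2 ⟨by norm_num, by norm_num⟩
  have h5 : √5 ≤ 2.236068 := sqrt_le_iff.2 ⟨by norm_num, by norm_num⟩
  have h1 : 1 ≤ √5 := one_le_sqrt.2 (by norm_num)
  have h35 : √3 * (1 + √5 / 3) ≤ 1.7321 * (1 + 2.236068 / 3) := by gcongr
  have hsin : 0.951 ≤ sin (2 * π / 5) := by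
    refine le_of_sq_le_sq ?_ (sin_nonneg_of_nonneg_of_le_pi (by positivity) (by linarith [pi_pos]))
    rw [sin_sq, cos_two_pi_div_five]
    nlinarith
  have hd : p5' = 1 * arccos (√5 / 3) +
      5 * (2 * sin (2 * π / 5) * -(2 * π / 25) + √3 * (1 + √5 / 3) * (π / 30)) := by
    have := hp.deriv
    simp only [id, hga, cos_side_eq] at this
    exact this
  rw [hd]
  have := arccos_sqrt_five_div_three_le
  nlinarith [pi_gt_d4, mul_le_mul_of_nonneg_left hsin pi_pos.le,
    mul_le_mul_of_nonneg_left h35 pi_pos.le]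

theorem le_cos_mul_cos_of_taylor {a y c : ℝ} (ha : 0 ≤ a) (hy : 0 ≤ y)
    (hy' : 0 ≤ 1 - y ^ 2 / 2 + y ^ 4 / 24 - y ^ 6 / 720)
    (ha' : 0 ≤ 1 - a ^ 2 / 2 + a ^ 4 / 24 - a ^ 6 / 720)
    (h : c ≤ (1 - a ^ 2 / 2 + a ^ 4 / 24 - a ^ 6 / 720) *
      (1 - y ^ 2 / 2 + y ^ 4 / 24 - y ^ 6 / 720)) : c ≤ cos a * cos y :=
  h.trans (mul_le_mul (taylor_six_le_cos ha) (taylor_six_le_cos hy) hy'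
    (ha'.trans (taylor_six_le_cos ha)))

/-- If the half side of the regular `n`-gon is bounded below at both ends of an interval of values
of `Y = (2π - x) / (2n)`, then `Ifun` is bounded below by linear interpolation. -/
theorem le_Ifun_of_segment {n A₀ A₁ Y₀ Y₁ s t ρ : ℝ} (hn : 5 ≤ n)
    (h₀ : cos (π / n) ≤ cos A₀ * cos Y₀) (h₁ : cos (π / n) ≤ cos A₁ * cos Y₁)
    (hA₀ : 0 ≤ A₀) (hA₁ : 0 ≤ A₁) (hY₀ : 0 ≤ Y₀) (hY₁ : 0 ≤ Y₁)
    (hAY₀ : A₀ + Y₀ ≤ 1.5) (hAY₁ : A₁ + Y₁ ≤ 1.5) (hs₀ : 0 ≤ s) (hs₁ : s ≤ 1)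
    (hρ₀ : 0 ≤ ρ) (hρ₁ : ρ ≤ 1) (ht₀ : -1 ≤ t) (ht₁ : t ≤ 0)
    (hY : 3.1415927 * (2 - ρ / 3) + t = ((1 - s) * Y₀ + s * Y₁) * (2 * n)) :
    2 * n * ((1 - s) * A₀ + s * A₁) + t * 1.51154 + (5 - n) * -0.069 - ρ * 3.64865 ≤
      Ifun (regPerim (ρ * π / 3 - t) n) n t ρ := by
  have hs₁' : 0 ≤ 1 - s := sub_nonneg.2 hs₁
  have hπ := pi_gt_three
  have hπ' : π ≤ 3.1415927 := pi_lt_d20.le.trans (by norm_num)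
  have hseg := le_cos_mul_cos_of_segment h₀ h₁ hA₀ hA₁ hY₀ hY₁ (by linarith) (by linarith) hs₀ hs₁
  have hA : 0 ≤ (1 - s) * A₀ + s * A₁ := by positivity
  have hA' : (1 - s) * A₀ + s * A₁ ≤ 1.5 := by nlinarith
  have hY' : (1 - s) * Y₀ + s * Y₁ ≤ 1.5 := by nlinarith
  have hy : (2 * π - (ρ * π / 3 - t)) / (2 * n) ≤ (1 - s) * Y₀ + s * Y₁ := by
    rw [div_le_iff₀ (by linarith), ← hY]
    nlinarith
  have hx : ρ * π / 3 - t ≤ 2 * π := by nlinarith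
  have hy₀ : 0 ≤ (2 * π - (ρ * π / 3 - t)) / (2 * n) :=
    div_nonneg (by linarith) (by linarith)
  have hP := le_regPerim (x := ρ * π / 3 - t) (by linarith) hA (by linarith)
    (by nlinarith) hx (hseg.trans (mul_le_mul_of_nonneg_left
      (cos_le_cos_of_nonneg_of_le_pi hy₀ (by linarith) hy)
      (cos_nonneg_of_neg_pi_div_two_le_of_le (by linarith) (by linarith))))
  unfold Ifun
  nlinarith [mul_le_mul_of_nonneg_left B'_ge (neg_nonneg.2 ht₁),
    mul_le_mul_of_nonneg_left p5'_le (sub_nonneg.2 hn), mul_le_mul_of_nonneg_left p5_le hρ₀]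

theorem cos_pi_div_seven_le : cos (π / 7) ≤ 0.90097 := by
  have h := cos_le_taylor_eight (show (0 : ℝ) ≤ 3.1415926 / 7 by norm_num)
  have hmono := cos_le_cos_of_nonneg_of_le_pi (show (0 : ℝ) ≤ 3.1415926 / 7 by norm_num)
    (by linarith [pi_pos]) (show 3.1415926 / 7 ≤ π / 7 by linarith [pi_gt_d20])
  refine hmono.trans (h.trans ?_)
  norm_num

theorem case_T_neg_rho_large :
    ∀ n ∈ ({5, 6, 7} : Set ℕ), ∀ t ∈ Set.Icc (T0 n) 0,
      ∀ ρ ∈ Set.Icc (rho2 n) (Rbd n),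
        Ifun (regPerim (ρ * π / 3 - t) (n : ℝ)) (n : ℝ) t ρ > 0 := by
  rintro n (rfl | rfl | rfl) t ⟨ht₀, ht₁⟩ ρ ⟨hρ₀, hρ₁⟩ <;>
    simp only [T0, rho2, Rbd] at ht₀ hρ₀ hρ₁ <;> norm_num at ht₀ hρ₀ hρ₁ <;> push_cast
  · have hc : cos (π / 5) ≤ 0.809017 := by
      have : √5 ≤ 2.236068 := sqrt_le_iff.2 ⟨by norm_num, by norm_num⟩
      rw [cos_pi_div_five]
      linarith
    refine lt_of_lt_of_le ?_ (le_Ifun_of_segment (A₀ := 0.350644) (A₁ := 0.384198)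
      (Y₀ := 0.5327095) (Y₁ := 0.510229)
      (s := (0.5327095 - (3.1415927 * (2 - ρ / 3) + t) / 10) / (0.5327095 - 0.510229)) ?_
      (hc.trans (le_cos_mul_cos_of_taylor ?_ ?_ ?_ ?_ ?_))
      (hc.trans (le_cos_mul_cos_of_taylor ?_ ?_ ?_ ?_ ?_)) ?_ ?_ ?_ ?_ ?_ ?_ ?_ ?_ ?_ ?_ ?_ ?_ ?_)
    all_goals norm_num <;> linarith
  · have hc : cos (π / 6) ≤ 0.8660255 := by
      have : √3 ≤ 1.732051 := sqrt_le_iff.2 ⟨by norm_num, by norm_num⟩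
      rw [cos_pi_div_six]
      linarith
    refine lt_of_lt_of_le ?_ (le_Ifun_of_segment (A₀ := 0.292825) (A₁ := 0.308014)
      (Y₀ := 0.4405212) (Y₁ := 0.4304073)
      (s := (0.4405212 - (3.1415927 * (2 - ρ / 3) + t) / 12) / (0.4405212 - 0.4304073)) ?_
      (hc.trans (le_cos_mul_cos_of_taylor ?_ ?_ ?_ ?_ ?_))
      (hc.trans (le_cos_mul_cos_of_taylor ?_ ?_ ?_ ?_ ?_)) ?_ ?_ ?_ ?_ ?_ ?_ ?_ ?_ ?_ ?_ ?_ ?_ ?_)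
    all_goals norm_num <;> linarith
  · refine lt_of_lt_of_le ?_ (le_Ifun_of_segment (A₀ := 0.253) (A₁ := 0.2556)
      (Y₀ := 0.3747472) (Y₁ := 0.3730262)
      (s := (0.3747472 - (3.1415927 * (2 - ρ / 3) + t) / 14) / (0.3747472 - 0.3730262)) ?_
      (cos_pi_div_seven_le.trans (le_cos_mul_cos_of_taylor ?_ ?_ ?_ ?_ ?_))
      (cos_pi_div_seven_le.trans (le_cos_mul_cos_of_taylor ?_ ?_ ?_ ?_ ?_))
      ?_ ?_ ?_ ?_ ?_ ?_ ?_ ?_ ?_ ?_ ?_ ?_ ?_)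
    all_goals norm_num <;> linarith
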